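/- Let M be a differential graded Lie algebra over ℂ and (A, m_A) a local Artinian ℂ-algebra with residue field ℂ. Let x(t,dt) ∈ MC_{M[t,dt]}(A) and μ(t,dt) ∈ (M[t,dt])^0 ⊗ m_A with μ(0) = 0 (evaluation at t = 0) and e^{μ(t,dt)} * x(t,dt) = x(t,dt). Then e^{μ(1)} belongs to the irrelevant stabilizer of x(1), i.e., there exists C ∈ M^{−1} ⊗ m_A such that μ(1) = d_M C + [x(1), C], where μ(1), x(1) denote evaluations at t = 1. -/

import Mathlib

noncomputable section

open TensorProduct

/-- Raw graded Lie data: a `ℤ`-graded complex vector space with a degree-one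
differential and a degree-zero bracket (no axioms). -/
structure GLD where
  V : ℤ → Type
  [grp : ∀ i, AddCommGroup (V i)]
  [mod : ∀ i, Module ℂ (V i)]
  d : ∀ i, V i → V (i + 1)
  br : ∀ i j, V i → V j → V (i + j)

attribute [instance] GLD.grp GLD.mod

namespace GLD

/-- Transport along an equality of degrees. -/
def tr (L : GLD) {i j : ℤ} (h : i = j) (x : L.V i) : L.V j := h ▸ x

/-- The Maurer-Cartan equation in degree one: `dx + ½[x,x] = 0`. -/
def MC1 (L : GLD) (x : L.V 1) : Prop :=
  L.d 1 x + (2 : ℂ)⁻¹ • L.br 1 1 x x = 0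

/-- The adjoint action of a degree-zero element on degree one. -/
def ad01 (L : GLD) (a : L.V 0) (x : L.V 1) : L.V 1 := L.tr (by omega) (L.br 0 1 a x)

/-- The adjoint action of a degree-zero element on degree zero. -/
def ad00 (L : GLD) (a : L.V 0) (x : L.V 0) : L.V 0 := L.tr (by omega) (L.br 0 0 a x)

/-- The gauge action `e^a * x = x + Σ_{n≥0} ad_a^n/(n+1)! ([a,x] - da)`. -/
def gauge (L : GLD) (a : L.V 0) (x : L.V 1) : L.V 1 :=
  x + ∑ᶠ n : ℕ, (((n+1).factorial : ℂ))⁻¹ •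
    (L.ad01 a)^[n] (L.ad01 a x - L.tr (by omega) (L.d 0 a))

/-- Right-nested bracket of a word in two degree-zero letters `x` (true) and `y` (false). -/
def nest (L : GLD) (x y : L.V 0) : List Bool → L.V 0
  | [] => 0
  | [b] => if b then x else y
  | b :: (c :: rest) => L.ad00 (if b then x else y) (L.nest x y (c :: rest))

end GLD

/-- The word `x^{r₁} y^{s₁} ⋯ x^{r_n} y^{s_n}` encoded as a list of booleans. -/
def bchWord (P : List (ℕ × ℕ)) : List Bool :=
  P.flatMap fun p => List.replicate p.1 true ++ List.replicate p.2 false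

open Classical in
/-- The coefficient in Dynkin's formula for the Baker-Campbell-Hausdorff series. -/
def bchCoeff (P : List (ℕ × ℕ)) : ℂ :=
  if P = [] ∨ ¬ (∀ p ∈ P, 0 < p.1 + p.2) then 0 else
    (-1 : ℂ) ^ (P.length - 1) / (P.length : ℂ) *
      ((((P.map fun p => p.1 + p.2).sum : ℕ) : ℂ) *
        (((P.map fun p => (p.1.factorial * p.2.factorial : ℕ)).prod : ℕ) : ℂ))⁻¹

/-- The Baker-Campbell-Hausdorff product on degree-zero elements, via Dynkin's formula. -/
def GLD.bch (L : GLD) (x y : L.V 0) : L.V 0 :=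
  ∑ᶠ P : List (ℕ × ℕ), bchCoeff P • L.nest x y (bchWord P)

/-- Differential graded Lie algebra over `ℂ`. -/
structure DGLA extends GLD where
  d_add : ∀ i (x y : V i), d i (x + y) = d i x + d i y
  d_smul : ∀ i (c : ℂ) (x : V i), d i (c • x) = c • d i x
  br_add_left : ∀ i j (x x' : V i) (y : V j), br i j (x + x') y = br i j x y + br i j x' y
  br_smul_left : ∀ i j (c : ℂ) (x : V i) (y : V j), br i j (c • x) y = c • br i j x y
  br_add_right : ∀ i j (x : V i) (y y' : V j), br i j x (y + y') = br i j x y + br i j x y'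
  br_smul_right : ∀ i j (c : ℂ) (x : V i) (y : V j), br i j x (c • y) = c • br i j x y
  d_sq : ∀ i (x : V i), d (i + 1) (d i x) = 0
  antisym : ∀ i j (x : V i) (y : V j),
    br i j x y = - toGLD.tr (by omega) (((Int.negOnePow (i * j) : ℤˣ) : ℤ) • br j i y x)
  leibniz : ∀ i j (x : V i) (y : V j),
    d (i + j) (br i j x y) =
      toGLD.tr (by omega) (br (i + 1) j (d i x) y) +
        ((Int.negOnePow i : ℤˣ) : ℤ) • toGLD.tr (by omega) (br i (j + 1) x (d j y))
  jacobi : ∀ i j k (x : V i) (y : V j) (z : V k),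
    br i (j + k) x (br j k y z) =
      toGLD.tr (by omega) (br (i + j) k (br i j x y) z) +
        ((Int.negOnePow (i * j) : ℤˣ) : ℤ) • toGLD.tr (by omega) (br j (i + k) y (br i k x z))

namespace DGLA

/-- The differential as a linear map. -/
def dLin (L : DGLA) (i : ℤ) : L.V i →ₗ[ℂ] L.V (i + 1) :=
  { toFun := L.d i, map_add' := L.d_add i, map_smul' := L.d_smul i }

/-- The bracket as a bilinear map. -/
def brLin (L : DGLA) (i j : ℤ) : L.V i →ₗ[ℂ] L.V j →ₗ[ℂ] L.V (i + j) :=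
  LinearMap.mk₂ ℂ (L.br i j) (L.br_add_left i j) (fun c x y => L.br_smul_left i j c x y)
    (L.br_add_right i j) (fun c x y => L.br_smul_right i j c x y)

end DGLA

/-- Morphism of (differential) graded Lie algebras (data-level). -/
structure GLDHom (L M : GLD) where
  f : ∀ i, L.V i → M.V i
  f_add : ∀ i (x y : L.V i), f i (x + y) = f i x + f i y
  f_smul : ∀ i (c : ℂ) (x : L.V i), f i (c • x) = c • f i x
  f_d : ∀ i (x : L.V i), f (i + 1) (L.d i x) = M.d i (f i x)
  f_br : ∀ i j (x : L.V i) (y : L.V j), f (i + j) (L.br i j x y) = M.br i j (f i x) (f j y)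

/-- The components of a morphism as linear maps. -/
def GLDHom.lin {L M : GLD} (h : GLDHom L M) (i : ℤ) : L.V i →ₗ[ℂ] M.V i :=
  { toFun := h.f i, map_add' := h.f_add i, map_smul' := h.f_smul i }

section ArtinBase

variable (A : Type) [CommRing A] [Algebra ℂ A] [IsLocalRing A]

/-- The maximal ideal of a local `ℂ`-algebra. -/
abbrev mA : Ideal A := IsLocalRing.maximalIdeal A

/-- Multiplication of the maximal ideal, as a `ℂ`-bilinear map. -/
def mMul : (mA A) →ₗ[ℂ] (mA A) →ₗ[ℂ] (mA A) :=
  LinearMap.mk₂ ℂ (fun x y => ⟨x.1 * y.1, Ideal.mul_mem_left _ _ y.2⟩)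
    (fun x x' y => by ext; simp [add_mul])
    (fun c x y => by ext; simp [smul_mul_assoc])
    (fun x y y' => by ext; simp [mul_add])
    (fun c x y => by ext; simp [mul_smul_comm])

/-- For a DGLA `L`, the graded Lie data on `L ⊗ m_A`. -/
def DGLA.ten (L : DGLA) : GLD where
  V i := L.V i ⊗[ℂ] (mA A)
  d i := fun x => LinearMap.rTensor (mA A) (L.dLin i) x
  br i j := fun x y =>
    TensorProduct.curry
      ((TensorProduct.map (TensorProduct.lift (L.brLin i j)) (TensorProduct.lift (mMul A)))
        ∘ₗ (TensorProduct.tensorTensorTensorComm ℂ (L.V i) (mA A) (L.V j) (mA A)).toLinearMap)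
      x y

end ArtinBase
namespace GLD

/-- Polynomial differential forms `W[t,dt]`:
in degree `n` an element is `(p, q)` representing `Σᵢ pᵢ tⁱ + Σᵢ qᵢ tⁱ dt`,
with `pᵢ ∈ W^n` and `qᵢ ∈ W^{n-1}`. -/
def tdt (W : GLD) : GLD where
  V n := (ℕ →₀ W.V n) × (ℕ →₀ W.V (n - 1))
  d n x :=
    (x.1.sum fun i v => Finsupp.single i (W.d n v),
      (x.2.sum fun i v => Finsupp.single i (W.tr (by omega) (W.d (n - 1) v))) +
        ((Int.negOnePow n : ℤˣ) : ℤ) •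
          x.1.sum fun i v => Finsupp.single (i - 1) ((i : ℂ) • W.tr (by omega) v))
  br n m x y :=
    (x.1.sum fun i v => y.1.sum fun j w => Finsupp.single (i + j) (W.br n m v w),
      (x.1.sum fun i v => y.2.sum fun j w =>
          Finsupp.single (i + j) (W.tr (by omega) (W.br n (m - 1) v w))) +
        ((Int.negOnePow m : ℤˣ) : ℤ) •
          x.2.sum fun i v => y.1.sum fun j w =>
            Finsupp.single (i + j) (W.tr (by omega) (W.br (n - 1) m v w)))

/-- Evaluation `e_a : W[t,dt] → W` at a point `a ∈ ℂ`. -/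
def evalT (W : GLD) (a : ℂ) (n : ℤ) (x : (W.tdt).V n) : W.V n :=
  x.1.sum fun i v => (a ^ i) • v

/-- The inclusion `W → W[t,dt]` of constant polynomials. -/
def constT (W : GLD) (n : ℤ) (v : W.V n) : (W.tdt).V n :=
  (Finsupp.single 0 v, 0)

/-- The integral operator `∫₀¹ : W[t,dt] → W` of degree `-1`. -/
def int01 (W : GLD) (n : ℤ) (x : (W.tdt).V n) : W.V (n - 1) :=
  x.2.sum fun i v => (((i : ℂ) + 1))⁻¹ • v

/-- The integral operator `∫₀ᵗ`, returning the polynomial primitive of the `dt`-part. -/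
def int0t (W : GLD) (n : ℤ) (x : (W.tdt).V n) : ℕ →₀ W.V (n - 1) :=
  x.2.sum fun i v => Finsupp.single (i + 1) ((((i : ℂ) + 1))⁻¹ • v)

/-- The standard homotopy `K(m(t,dt)) = t∫₀¹ m − ∫₀ᵗ m` on `W[t,dt]`, of degree `-1`. -/
def Ktdt (W : GLD) (n : ℤ) (x : (W.tdt).V n) : (W.tdt).V (n - 1) :=
  (Finsupp.single 1 (W.int01 n x) - W.int0t n x, 0)

/-- A degreewise map between graded objects is a quasi-isomorphism: elementwise,
it induces a bijection on cohomology in every degree. -/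
def IsQuasiIso (L M : GLD) (f : ∀ i, L.V i → M.V i) : Prop :=
  ∀ i : ℤ,
    (∀ x : M.V i, M.d i x = 0 →
      ∃ y : L.V i, L.d i y = 0 ∧ ∃ z : M.V (i - 1), x = f i y + M.tr (by omega) (M.d (i - 1) z)) ∧
    (∀ y : L.V i, L.d i y = 0 →
      (∃ z : M.V (i - 1), f i y = M.tr (by omega) (M.d (i - 1) z)) →
      ∃ w : L.V (i - 1), y = L.tr (by omega) (L.d (i - 1) w))

/-- Extension of a degreewise map to polynomial differential forms, coefficientwise. -/
def tdtMap {W W' : GLD} (f : ∀ i, W.V i → W'.V i) (n : ℤ) (x : (W.tdt).V n) : (W'.tdt).V n :=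
  (x.1.sum fun i v => Finsupp.single i (f n v),
   x.2.sum fun i v => Finsupp.single i (f (n - 1) v))

end GLD

section Polynomials

variable {U V W : Type*} [AddCommGroup U] [Module ℂ U] [AddCommGroup V] [Module ℂ V]
  [AddCommGroup W] [Module ℂ W]

/-- The Cauchy product of polynomials with coefficients in modules, along a bilinear map. -/
def cauchyProd (B : U →ₗ[ℂ] V →ₗ[ℂ] W) : (ℕ →₀ U) →ₗ[ℂ] (ℕ →₀ V) →ₗ[ℂ] (ℕ →₀ W) :=
  LinearMap.mk₂ ℂ (fun x y => x.sum fun i v => y.sum fun j w => Finsupp.single (i + j) (B v w))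
    (fun x x' y => Finsupp.sum_add_index' (by simp)
      (by intro i v v'; simp [Finsupp.sum_add]))
    (fun c x y => by
      rw [Finsupp.sum_smul_index' (by simp), Finsupp.smul_sum]
      simp [Finsupp.smul_sum])
    (fun x y y' => by
      rw [← Finsupp.sum_add]
      refine Finsupp.sum_congr fun i _ => Finsupp.sum_add_index' (by simp) (by simp))
    (fun c x y => by
      rw [Finsupp.smul_sum]
      refine Finsupp.sum_congr fun i _ => ?_
      rw [Finsupp.sum_smul_index' (by simp), Finsupp.smul_sum]
      simp)

lemma cauchyProd_apply (B : U →ₗ[ℂ] V →ₗ[ℂ] W) (x : ℕ →₀ U) (y : ℕ →₀ V) :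
    cauchyProd B x y =
      x.sum fun i v => y.sum fun j w => Finsupp.single (i + j) (B v w) := rfl

@[simp]
lemma cauchyProd_single (B : U →ₗ[ℂ] V →ₗ[ℂ] W) (i j : ℕ) (u : U) (v : V) :
    cauchyProd B (Finsupp.single i u) (Finsupp.single j v) = Finsupp.single (i + j) (B u v) := by
  simp [cauchyProd_apply]

lemma cauchyProd_neg (B : U →ₗ[ℂ] V →ₗ[ℂ] W) (x : ℕ →₀ U) (y : ℕ →₀ V) :
    cauchyProd (-B) x y = - cauchyProd B x y := by
  simp [cauchyProd_apply, Finsupp.sum]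

lemma cauchyProd_flip (B : U →ₗ[ℂ] V →ₗ[ℂ] W) (B' : V →ₗ[ℂ] U →ₗ[ℂ] W)
    (h : ∀ u v, B u v = B' v u) (x : ℕ →₀ U) (y : ℕ →₀ V) :
    cauchyProd B x y = cauchyProd B' y x := by
  rw [cauchyProd_apply, Finsupp.sum_comm]
  simp only [h, add_comm]
  rfl

lemma cauchyProd_apply_zero (B : U →ₗ[ℂ] V →ₗ[ℂ] W) (x : ℕ →₀ U) (y : ℕ →₀ V) :
    cauchyProd B x y 0 = B (x 0) (y 0) := by
  induction x using Finsupp.induction_linear with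
  | zero => simp
  | add x x' hx hx' => simp [hx, hx']
  | single i u =>
  induction y using Finsupp.induction_linear with
  | zero => simp
  | add y y' hy hy' => simp only [map_add, Finsupp.add_apply, hy, hy']
  | single j v => rcases i with _ | i <;> rcases j with _ | j <;> simp [← add_assoc]

lemma cauchyProd_mem (B : U →ₗ[ℂ] V →ₗ[ℂ] W) {P : Submodule ℂ V} {Q : Submodule ℂ W}
    (h : ∀ u, ∀ v ∈ P, B u v ∈ Q) (x : ℕ →₀ U) {y : ℕ →₀ V}
    (hy : y ∈ Finsupp.submodule fun _ : ℕ => P) :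
    cauchyProd B x y ∈ Finsupp.submodule fun _ : ℕ => Q := by
  refine Submodule.sum_mem _ fun i _ => Submodule.sum_mem _ fun j _ => ?_
  intro n
  by_cases hn : i + j = n
  · simpa [hn] using h _ _ (hy j)
  · simp [hn]

/-- Formal derivative of polynomials with coefficients in a module. -/
def polyDeriv : (ℕ →₀ V) →ₗ[ℂ] (ℕ →₀ V) :=
  Finsupp.lsum ℂ fun i => (Finsupp.lsingle (i - 1)) ∘ₗ ((i : ℂ) • LinearMap.id)

lemma polyDeriv_eq_sum (x : ℕ →₀ V) :
    polyDeriv x = x.sum fun i v => Finsupp.single (i - 1) ((i : ℂ) • v) := rfl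

@[simp]
lemma polyDeriv_single (i : ℕ) (v : V) :
    polyDeriv (Finsupp.single i v) = Finsupp.single (i - 1) ((i : ℂ) • v) := by
  simp [polyDeriv_eq_sum]

lemma polyDeriv_apply (x : ℕ →₀ V) (n : ℕ) : polyDeriv x n = ((n : ℂ) + 1) • x (n + 1) := by
  induction x using Finsupp.induction_linear with
  | zero => simp
  | add x y hx hy => simp [hx, hy]
  | single i v =>
    rcases i with _ | i
    · simp
    · by_cases h : i = n
      · simp [h]
      · simp [h]

/-- Formal primitive of polynomials with coefficients in a module, vanishing at `0`. -/
def polyInt : (ℕ →₀ V) →ₗ[ℂ] (ℕ →₀ V) :=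
  Finsupp.lsum ℂ fun i => (Finsupp.lsingle (i + 1)) ∘ₗ (((i : ℂ) + 1)⁻¹ • LinearMap.id)

@[simp]
lemma polyInt_single (i : ℕ) (v : V) :
    polyInt (Finsupp.single i v) = Finsupp.single (i + 1) (((i : ℂ) + 1)⁻¹ • v) := by
  simp [polyInt]

lemma polyInt_apply_zero (x : ℕ →₀ V) : polyInt x 0 = 0 := by
  induction x using Finsupp.induction_linear with
  | zero => simp
  | add x y hx hy => simp [hx, hy]
  | single i v => simp

lemma polyDeriv_polyInt (x : ℕ →₀ V) : polyDeriv (polyInt x) = x := by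
  induction x using Finsupp.induction_linear with
  | zero => simp
  | add x y hx hy => simp [hx, hy]
  | single i v =>
    have : (i : ℂ) + 1 ≠ 0 := Nat.cast_add_one_ne_zero i
    simp [smul_smul, this]

lemma polyInt_mem {P : Submodule ℂ V} {x : ℕ →₀ V}
    (hx : x ∈ Finsupp.submodule fun _ : ℕ => P) :
    polyInt x ∈ Finsupp.submodule fun _ : ℕ => P := by
  refine Submodule.sum_mem _ fun i _ n => ?_
  by_cases hn : i + 1 = n
  · simpa [hn] using P.smul_mem _ (hx i)
  · simp [hn]

/-- Coefficientwise application of a linear map to polynomials. -/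
abbrev polyMap (f : U →ₗ[ℂ] V) : (ℕ →₀ U) →ₗ[ℂ] (ℕ →₀ V) := Finsupp.mapRange.linearMap f

lemma polyDeriv_polyMap (f : U →ₗ[ℂ] V) (x : ℕ →₀ U) :
    polyDeriv (polyMap f x) = polyMap f (polyDeriv x) := by
  induction x using Finsupp.induction_linear with
  | zero => simp
  | add x y hx hy => simp only [map_add, hx, hy]
  | single i v => simp

lemma polyMap_eq_sum (f : U →ₗ[ℂ] V) (x : ℕ →₀ U) :
    polyMap f x = x.sum fun i v => Finsupp.single i (f v) := by
  induction x using Finsupp.induction_linear with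
  | zero => simp
  | add x y hx hy => rw [map_add, hx, hy, Finsupp.sum_add_index'] <;> simp
  | single i v => simp

lemma polyDeriv_cauchyProd (B : U →ₗ[ℂ] V →ₗ[ℂ] W) (x : ℕ →₀ U) (y : ℕ →₀ V) :
    polyDeriv (cauchyProd B x y) =
      cauchyProd B (polyDeriv x) y + cauchyProd B x (polyDeriv y) := by
  induction x using Finsupp.induction_linear with
  | zero => simp
  | add x x' hx hx' => simp only [map_add, LinearMap.add_apply, hx, hx']; abel
  | single i u =>
  induction y using Finsupp.induction_linear with
  | zero => simp
  | add y y' hy hy' => simp only [map_add, hy, hy']; abel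
  | single j v =>
    rcases i with _ | i
    · simp
    rcases j with _ | j
    · simp
    have h₁ : i + 1 + (j + 1) - 1 = i + j + 1 := by omega
    have h₂ : i + (j + 1) = i + j + 1 := by omega
    have h₃ : i + 1 + j = i + j + 1 := by omega
    simp only [cauchyProd_single, polyDeriv_single, Nat.add_sub_cancel, h₁, h₂, h₃, map_smul,
      LinearMap.smul_apply, ← Finsupp.single_add, ← add_smul, Nat.cast_add]

/-- A polynomial vanishing at `0` and solving a homogeneous linear differential equation
is zero. -/
lemma eq_zero_of_polyDeriv_eq (B : U →ₗ[ℂ] V →ₗ[ℂ] V) (q : ℕ →₀ U) (e : ℕ →₀ V)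
    (h0 : e 0 = 0) (he : polyDeriv e = cauchyProd B q e) : e = 0 := by
  have key : ∀ n, ∀ k ≤ n, e k = 0 := by
    intro n
    induction n with
    | zero => intro k hk; rwa [Nat.le_zero.mp hk]
    | succ n ih =>
      intro k hk
      rcases hk.lt_or_eq with hk | rfl
      · exact ih k (by omega)
      have h1 := polyDeriv_apply e n
      rw [he, cauchyProd_apply] at h1
      have h2 : (q.sum fun i v => e.sum fun j w => Finsupp.single (i + j) (B v w)) n = 0 := by
        simp only [Finsupp.sum, Finsupp.finsetSum_apply]
        refine Finset.sum_eq_zero fun i _ => Finset.sum_eq_zero fun j _ => ?_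
        by_cases hij : i + j = n
        · simp [ih j (by omega)]
        · simp [hij]
      rw [h2] at h1
      exact (smul_eq_zero.mp h1.symm).resolve_left (Nat.cast_add_one_ne_zero n)
  ext n
  exact key n n le_rfl

/-- Evaluation at `1` of a polynomial with coefficients in a module. -/
def polyEvalOne : (ℕ →₀ V) →ₗ[ℂ] V := Finsupp.lsum ℂ fun _ => LinearMap.id

@[simp]
lemma polyEvalOne_single (i : ℕ) (v : V) : polyEvalOne (Finsupp.single i v) = v := by
  simp [polyEvalOne]

lemma polyEvalOne_polyMap (f : U →ₗ[ℂ] V) (x : ℕ →₀ U) :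
    polyEvalOne (polyMap f x) = f (polyEvalOne x) := by
  induction x using Finsupp.induction_linear with
  | zero => simp
  | add x y hx hy => simp only [map_add, hx, hy]
  | single i v => simp

lemma polyEvalOne_cauchyProd (B : U →ₗ[ℂ] V →ₗ[ℂ] W) (x : ℕ →₀ U) (y : ℕ →₀ V) :
    polyEvalOne (cauchyProd B x y) = B (polyEvalOne x) (polyEvalOne y) := by
  induction x using Finsupp.induction_linear with
  | zero => simp
  | add x x' hx hx' => simp [hx, hx']
  | single i u =>
  induction y using Finsupp.induction_linear with
  | zero => simp
  | add y y' hy hy' => simp [hy, hy']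
  | single j v => simp

lemma polyEval_one (x : ℕ →₀ V) : (x.sum fun i v => (1 : ℂ) ^ i • v) = polyEvalOne x := by
  simp only [one_pow, one_smul]
  rfl

lemma polyEval_zero (x : ℕ →₀ V) : (x.sum fun i v => (0 : ℂ) ^ i • v) = x 0 := by
  rw [Finsupp.sum, Finset.sum_eq_single 0]
  · simp
  · intro i _ hi; simp [hi]
  · intro h; simpa using h

end Polynomials

lemma Module.End.isNilpotent_of_filtration {V : Type*} [AddCommGroup V] [Module ℂ V]
    (T : Module.End ℂ V) (F : ℕ → Submodule ℂ V) (h0 : F 0 = ⊤) {N : ℕ} (hN : F N = ⊥)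
    (hT : ∀ k, ∀ v ∈ F k, T v ∈ F (k + 1)) : IsNilpotent T := by
  have h : ∀ k v, (T ^ k) v ∈ F k := by
    intro k
    induction k with
    | zero => simp [h0]
    | succ k ih => intro v; rw [pow_succ']; exact hT k _ (ih v)
  refine ⟨N, LinearMap.ext fun v => ?_⟩
  simpa [hN] using h N v

lemma eq_zero_of_finsum_iterate_eq_zero {V : Type*} [AddCommGroup V] [Module ℂ V]
    (T : Module.End ℂ V) (hT : IsNilpotent T) (y : V)
    (h : ∑ᶠ n : ℕ, (((n+1).factorial : ℂ))⁻¹ • T^[n] y = 0) : y = 0 := by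
  obtain ⟨N, hN⟩ := hT
  have hN' : T ^ (N + 1) = 0 := by rw [pow_succ, hN, zero_mul]
  have hsupp : (Function.support fun n : ℕ => (((n+1).factorial : ℂ))⁻¹ • T^[n] y) ⊆
      (Finset.range (N + 1) : Set ℕ) := by
    intro n hn
    by_contra hlt
    simp only [Finset.coe_range, Set.mem_Iio, not_lt] at hlt
    apply hn
    have : T ^ n = 0 := pow_eq_zero_of_le hlt hN'
    simp only [← Module.End.pow_apply, this, LinearMap.zero_apply, smul_zero]
  rw [finsum_eq_sum_of_support_subset _ hsupp, Finset.sum_range_succ'] at h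
  set S : Module.End ℂ V := ∑ n ∈ Finset.range N, (((n + 1 + 1).factorial : ℂ))⁻¹ • T ^ n
  have hcomm : Commute T S :=
    Commute.sum_right _ _ _ fun n _ => ((Commute.refl T).pow_right n).smul_right _
  have hnil : IsNilpotent (T * S) := hcomm.isNilpotent_mul_right ⟨N, hN⟩
  have hunit : IsUnit (T * S + 1) := hnil.isUnit_add_one
  have hy : (T * S + 1) y = 0 := by
    rw [← h]
    simp [S, Finset.mul_sum, LinearMap.sum_apply, ← Module.End.pow_apply, pow_succ']
  exact (Module.End.isUnit_iff _).mp hunit |>.injective (by rw [hy, map_zero])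

section TwistedPrimitive

variable {Vm V₀ V₁ : Type*} [AddCommGroup Vm] [Module ℂ Vm] [AddCommGroup V₀] [Module ℂ V₀]
  [AddCommGroup V₁] [Module ℂ V₁]

lemma exists_twisted_primitive (D : Vm →ₗ[ℂ] V₀) (D₀ : V₀ →ₗ[ℂ] V₁)
    (B1m : V₁ →ₗ[ℂ] Vm →ₗ[ℂ] V₀) (B0m : V₀ →ₗ[ℂ] Vm →ₗ[ℂ] Vm) (B00 : V₀ →ₗ[ℂ] V₀ →ₗ[ℂ] V₀)
    (B10 : V₁ →ₗ[ℂ] V₀ →ₗ[ℂ] V₁)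
    (hleib : ∀ q c, D (B0m q c) = B1m (D₀ q) c + B00 q (D c))
    (hjac : ∀ p q c, B1m p (B0m q c) = B1m (B10 p q) c + B00 q (B1m p c))
    (F : ℕ → Submodule ℂ Vm) (hF0 : F 0 = ⊤) {N : ℕ} (hFN : F N = ⊥)
    (hF : ∀ k u, ∀ v ∈ F k, B0m u v ∈ F (k + 1))
    (p : ℕ →₀ V₁) (q a : ℕ →₀ V₀) (b : ℕ →₀ Vm)
    (hp : polyDeriv p = polyMap D₀ q + cauchyProd B10 p q)
    (ha : polyDeriv a = - cauchyProd B00 q a - polyMap D b - cauchyProd B1m p b)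
    (ha0 : a 0 = 0) :
    ∃ c, a = polyMap D c + cauchyProd B1m p c := by
  have hleib' : ∀ q c, polyMap D (cauchyProd B0m q c) =
      cauchyProd B1m (polyMap D₀ q) c + cauchyProd B00 q (polyMap D c) := by
    intro q c
    induction q using Finsupp.induction_linear with
    | zero => simp
    | add x y hx hy => simp only [map_add, LinearMap.add_apply, hx, hy]; abel
    | single i u =>
    induction c using Finsupp.induction_linear with
    | zero => simp
    | add x y hx hy => simp only [map_add, hx, hy]; abel
    | single j v => simp [hleib]
  have hjac' : ∀ p q c, cauchyProd B1m p (cauchyProd B0m q c) =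
      cauchyProd B1m (cauchyProd B10 p q) c + cauchyProd B00 q (cauchyProd B1m p c) := by
    intro p q c
    induction p using Finsupp.induction_linear with
    | zero => simp
    | add x y hx hy => simp only [map_add, LinearMap.add_apply, hx, hy]; abel
    | single k w =>
    induction q using Finsupp.induction_linear with
    | zero => simp
    | add x y hx hy => simp only [map_add, LinearMap.add_apply, hx, hy]; abel
    | single i u =>
    induction c using Finsupp.induction_linear with
    | zero => simp
    | add x y hx hy => simp only [map_add, hx, hy]; abel
    | single j v => simp [hjac, add_assoc, add_left_comm i k j]
  let T : Module.End ℂ (ℕ →₀ Vm) := polyInt ∘ₗ cauchyProd B0m q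
  have hT : IsNilpotent T := by
    refine T.isNilpotent_of_filtration (fun k => Finsupp.submodule fun _ => F k)
      (N := N) ?_ ?_ fun k v hv => polyInt_mem (cauchyProd_mem _ (hF k) q hv)
    · ext; simp [hF0]
    · ext v; simp [hFN, Finsupp.mem_submodule_iff, Finsupp.ext_iff]
  obtain ⟨c, hc⟩ := ((Module.End.isUnit_iff _).mp hT.isUnit_one_add).surjective (-polyInt b)
  replace hc : c = - polyInt b - polyInt (cauchyProd B0m q c) := by
    rw [← hc]; simp [T]
  have hc0 : c 0 = 0 := by rw [hc]; simp [polyInt_apply_zero]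
  have hc' : polyDeriv c = - b - cauchyProd B0m q c := by
    conv_lhs => rw [hc]
    simp only [map_sub, map_neg, polyDeriv_polyInt]
  refine ⟨c, sub_eq_zero.mp (eq_zero_of_polyDeriv_eq (-B00) q _ ?_ ?_)⟩
  · simp [ha0, hc0, cauchyProd_apply_zero]
  · rw [cauchyProd_neg]
    simp only [map_sub, map_add, map_neg, polyDeriv_cauchyProd, polyDeriv_polyMap, ha, hp, hc',
      hleib', hjac', LinearMap.add_apply]
    abel

end TwistedPrimitive

lemma exists_mA_pow_eq_bot (A : Type) [CommRing A] [IsLocalRing A] [IsArtinianRing A] :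
    ∃ N, mA A ^ N = ⊥ := by
  obtain ⟨N, hN⟩ := IsArtinianRing.isNilpotent_jacobson_bot (R := A)
  rw [IsLocalRing.jacobson_eq_maximalIdeal _ bot_ne_top] at hN
  exact ⟨N, hN⟩

section TensorArtin

variable (M : DGLA) (A : Type) [CommRing A] [Algebra ℂ A] [IsLocalRing A]

/-- The differential of `M ⊗ m_A` as a linear map into any degree equal to `i + 1`. -/
def DGLA.tenD (i k : ℤ) (h : i + 1 = k) : (M.ten A).V i →ₗ[ℂ] (M.ten A).V k :=
  LinearMap.rTensor (mA A) (h ▸ M.dLin i)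

/-- The bracket of `M ⊗ m_A` as a bilinear map into any degree equal to `i + j`. -/
def DGLA.tenBr (i j k : ℤ) (h : i + j = k) :
    (M.ten A).V i →ₗ[ℂ] (M.ten A).V j →ₗ[ℂ] (M.ten A).V k :=
  TensorProduct.curry
    ((TensorProduct.map (TensorProduct.lift (h ▸ M.brLin i j)) (TensorProduct.lift (mMul A)))
      ∘ₗ (TensorProduct.tensorTensorTensorComm ℂ (M.V i) (mA A) (M.V j) (mA A)).toLinearMap)

/-- The pure tensor `m ⊗ a` as an element of `M ⊗ m_A`. -/
def DGLA.tenMk {M : DGLA} {A : Type} [CommRing A] [Algebra ℂ A] [IsLocalRing A] {i : ℤ}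
    (m : M.V i) (a : mA A) : (M.ten A).V i :=
  m ⊗ₜ[ℂ] a

/-- The `k`-th step `M ⊗ m_A ∩ m_A ^ k` of the `m_A`-adic filtration of `M ⊗ m_A`. -/
def DGLA.tenFil (i : ℤ) (k : ℕ) : Submodule ℂ ((M.ten A).V i) :=
  Submodule.span ℂ {z | ∃ (m : M.V i) (a : mA A), (a : A) ∈ mA A ^ k ∧ z = tenMk m a}

namespace DGLA

variable {M A}

lemma tr_d_eq_tenD {i k : ℤ} (h : i + 1 = k) (x : (M.ten A).V i) :
    (M.ten A).tr h ((M.ten A).d i x) = M.tenD A i k h x := by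
  subst h; rfl

lemma tr_br_eq_tenBr {i j k : ℤ} (h : i + j = k) (x : (M.ten A).V i) (y : (M.ten A).V j) :
    (M.ten A).tr h ((M.ten A).br i j x y) = M.tenBr A i j k h x y := by
  subst h; rfl

lemma tenD_tmul {i k : ℤ} (h : i + 1 = k) (m : M.V i) (a : mA A) :
    M.tenD A i k h (tenMk m a) = tenMk (M.tr h (M.d i m)) a := by
  subst h; rfl

lemma tenBr_tmul {i j k : ℤ} (h : i + j = k) (m : M.V i) (n : M.V j) (a b : mA A) :
    M.tenBr A i j k h (tenMk m a) (tenMk n b) =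
      tenMk (M.tr h (M.br i j m n)) (mMul A a b) := by
  subst h; rfl

@[elab_as_elim]
lemma ten_induction {i : ℤ} {P : (M.ten A).V i → Prop} (x : (M.ten A).V i) (zero : P 0)
    (tmul : ∀ (m : M.V i) (a : mA A), P (tenMk m a)) (add : ∀ x y, P x → P y → P (x + y)) :
    P x :=
  TensorProduct.induction_on (motive := P) x zero tmul add

lemma tenFil_zero (i : ℤ) : M.tenFil A i 0 = ⊤ := by
  refine eq_top_iff.mpr fun x _ => ?_
  induction x using ten_induction with
  | zero => exact zero_mem _
  | add x y hx hy => exact add_mem (hx trivial) (hy trivial)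
  | tmul m a => exact Submodule.subset_span ⟨m, a, by simp, rfl⟩

lemma tenFil_eq_bot (i : ℤ) {N : ℕ} (hN : mA A ^ N = ⊥) : M.tenFil A i N = ⊥ := by
  refine Submodule.span_eq_bot.mpr ?_
  rintro z ⟨m, a, ha, rfl⟩
  rw [hN, Ideal.mem_bot] at ha
  obtain rfl : a = 0 := Subtype.ext ha
  exact TensorProduct.tmul_zero _ m

lemma tenBr_mem_tenFil {i j k : ℤ} (h : i + j = k) (n : ℕ) (u : (M.ten A).V i)
    (v : (M.ten A).V j) (hv : v ∈ M.tenFil A j n) :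
    M.tenBr A i j k h u v ∈ M.tenFil A k (n + 1) := by
  induction hv using Submodule.span_induction with
  | zero => simp
  | add x y _ _ hx hy => rw [map_add]; exact add_mem hx hy
  | smul c x _ hx => rw [map_smul]; exact Submodule.smul_mem _ c hx
  | mem x hx =>
    obtain ⟨m, a, ha, rfl⟩ := hx
    induction u using ten_induction with
    | zero => simp
    | add x y hx hy => rw [map_add]; exact add_mem hx hy
    | tmul l b =>
      rw [tenBr_tmul]
      exact Submodule.subset_span ⟨_, _, by
        rw [pow_succ']; exact Ideal.mul_mem_mul b.2 ha, rfl⟩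

lemma mMul_comm (a b : mA A) : mMul A a b = mMul A b a := Subtype.ext (mul_comm _ _)

lemma mMul_assoc (a b c : mA A) : mMul A (mMul A a b) c = mMul A a (mMul A b c) :=
  Subtype.ext (mul_assoc _ _ _)

lemma tenMk_add {i : ℤ} (m n : M.V i) (a : mA A) :
    tenMk (m + n) a = tenMk m a + tenMk n a :=
  TensorProduct.add_tmul m n a

lemma tenMk_neg {i : ℤ} (m : M.V i) (a : mA A) : tenMk (-m) a = - tenMk m a :=
  TensorProduct.neg_tmul m a

lemma tenBr_zero_one (v : (M.ten A).V 0) (u : (M.ten A).V 1) :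
    M.tenBr A 0 1 1 rfl v u = - M.tenBr A 1 0 1 rfl u v := by
  induction u using ten_induction with
  | zero => simp
  | add x y hx hy => simp only [map_add, LinearMap.add_apply, hx, hy]; abel
  | tmul m a =>
  induction v using ten_induction with
  | zero => simp
  | add x y hx hy => simp only [map_add, LinearMap.add_apply, hx, hy]; abel
  | tmul n b =>
    have h : M.br 0 1 n m = - M.br 1 0 m n := by
      have h := M.antisym 0 1 n m
      rw [zero_mul, Int.negOnePow_zero, Units.val_one, one_smul] at h
      exact h
    rw [tenBr_tmul, tenBr_tmul, mMul_comm b a, ← tenMk_neg]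
    exact congrArg (fun z => tenMk z _) h

lemma tenBr_zero_zero (v u : (M.ten A).V 0) :
    M.tenBr A 0 0 0 rfl v u = - M.tenBr A 0 0 0 rfl u v := by
  induction u using ten_induction with
  | zero => simp
  | add x y hx hy => simp only [map_add, LinearMap.add_apply, hx, hy]; abel
  | tmul m a =>
  induction v using ten_induction with
  | zero => simp
  | add x y hx hy => simp only [map_add, LinearMap.add_apply, hx, hy]; abel
  | tmul n b =>
    have h : M.br 0 0 n m = - M.br 0 0 m n := by
      have h := M.antisym 0 0 n m
      rw [zero_mul, Int.negOnePow_zero, Units.val_one, one_smul] at h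
      exact h
    rw [tenBr_tmul, tenBr_tmul, mMul_comm b a, ← tenMk_neg]
    exact congrArg (fun z => tenMk z _) h

lemma tenBr_neg_one_one (v : (M.ten A).V (-1)) (u : (M.ten A).V 1) :
    M.tenBr A (-1) 1 0 rfl v u = M.tenBr A 1 (-1) 0 rfl u v := by
  induction u using ten_induction with
  | zero => simp
  | add x y hx hy => simp only [map_add, LinearMap.add_apply, hx, hy]
  | tmul m a =>
  induction v using ten_induction with
  | zero => simp
  | add x y hx hy => simp only [map_add, LinearMap.add_apply, hx, hy]
  | tmul n b =>
    have h : M.br (-1) 1 n m = M.br 1 (-1) m n := by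
      have h := M.antisym (-1) 1 n m
      rw [mul_one, Int.negOnePow_neg, Int.negOnePow_one, Units.val_neg, Units.val_one,
        neg_one_smul] at h
      exact h.trans (neg_neg (M.br 1 (-1) m n))
    rw [tenBr_tmul, tenBr_tmul, mMul_comm b a]
    exact congrArg (fun z => tenMk z _) h

lemma tenD_tenBr (q : (M.ten A).V 0) (c : (M.ten A).V (-1)) :
    M.tenD A (-1) 0 rfl (M.tenBr A 0 (-1) (-1) rfl q c) =
      M.tenBr A 1 (-1) 0 rfl (M.tenD A 0 1 rfl q) c +
        M.tenBr A 0 0 0 rfl q (M.tenD A (-1) 0 rfl c) := by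
  induction q using ten_induction with
  | zero => simp
  | add x y hx hy => simp only [map_add, LinearMap.add_apply, hx, hy]; abel
  | tmul m a =>
  induction c using ten_induction with
  | zero => simp
  | add x y hx hy => simp only [map_add, hx, hy]; abel
  | tmul n b =>
    have h := M.leibniz 0 (-1) m n
    rw [Int.negOnePow_zero, Units.val_one, one_smul] at h
    simp only [tenBr_tmul, tenD_tmul, ← tenMk_add]
    exact congrArg (fun z : M.V 0 => tenMk z _) h

lemma tenBr_jacobi (p : (M.ten A).V 1) (q : (M.ten A).V 0) (c : (M.ten A).V (-1)) :
    M.tenBr A 1 (-1) 0 rfl p (M.tenBr A 0 (-1) (-1) rfl q c) =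
      M.tenBr A 1 (-1) 0 rfl (M.tenBr A 1 0 1 rfl p q) c +
        M.tenBr A 0 0 0 rfl q (M.tenBr A 1 (-1) 0 rfl p c) := by
  induction p using ten_induction with
  | zero => simp
  | add x y hx hy => simp only [map_add, LinearMap.add_apply, hx, hy]; abel
  | tmul l e =>
  induction q using ten_induction with
  | zero => simp
  | add x y hx hy => simp only [map_add, LinearMap.add_apply, hx, hy]; abel
  | tmul m a =>
  induction c using ten_induction with
  | zero => simp
  | add x y hx hy => simp only [map_add, hx, hy]; abel
  | tmul n b =>
    have h := M.jacobi 1 0 (-1) l m n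
    rw [mul_zero, Int.negOnePow_zero, Units.val_one, one_smul] at h
    simp only [tenBr_tmul]
    rw [← mMul_assoc a e b, mMul_comm a e, mMul_assoc e a b, ← tenMk_add]
    exact congrArg (fun z : M.V 0 => tenMk z _) h

end DGLA

end TensorArtin

section Forms

variable {M : DGLA} {A : Type} [CommRing A] [Algebra ℂ A] [IsLocalRing A]

/-- The degree-zero polynomial form `a(t) + b(t) dt`. -/
def GLD.formZero {W : GLD} (a : ℕ →₀ W.V 0) (b : ℕ →₀ W.V (-1)) : W.tdt.V 0 := (a, b)

/-- The degree-one polynomial form `p(t) + q(t) dt`. -/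
def GLD.formOne {W : GLD} (p : ℕ →₀ W.V 1) (q : ℕ →₀ W.V 0) : W.tdt.V 1 := (p, q)

open DGLA

lemma polyDeriv_eq_of_MC1 (p : ℕ →₀ (M.ten A).V 1) (q : ℕ →₀ (M.ten A).V 0)
    (hx : ((M.ten A).tdt).MC1 (GLD.formOne p q)) :
    polyDeriv p =
      polyMap (M.tenD A 0 1 rfl) q + cauchyProd (M.tenBr A 1 0 1 rfl) p q := by
  have h : polyMap (M.tenD A 0 1 rfl) q + (-1 : ℤ) • polyDeriv p
        + (2 : ℂ)⁻¹ • (cauchyProd (M.tenBr A 1 0 1 rfl) p q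
          + (-1 : ℤ) • cauchyProd (M.tenBr A 0 1 1 rfl) q p) = 0 := by
    rw [polyMap_eq_sum]
    exact congrArg Prod.snd hx
  rw [cauchyProd_flip (M.tenBr A 0 1 1 rfl) (-M.tenBr A 1 0 1 rfl) (fun u v => by
    rw [tenBr_zero_one]; rfl), cauchyProd_neg, neg_one_smul, neg_one_smul, neg_neg,
    ← two_smul ℂ (cauchyProd _ p q), inv_smul_smul₀ two_ne_zero] at h
  rw [← sub_eq_zero, ← neg_eq_zero, ← h]
  abel

/-- The adjoint action of a degree-zero polynomial form on degree-one polynomial forms,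
split into its coefficients. -/
def formAd (a : ℕ →₀ (M.ten A).V 0) (b : ℕ →₀ (M.ten A).V (-1)) :
    Module.End ℂ ((ℕ →₀ (M.ten A).V 1) × (ℕ →₀ (M.ten A).V 0)) :=
  LinearMap.prod (cauchyProd (M.tenBr A 0 1 1 rfl) a ∘ₗ LinearMap.fst ℂ _ _)
    (cauchyProd (M.tenBr A 0 0 0 rfl) a ∘ₗ LinearMap.snd ℂ _ _ +
      (-1 : ℤ) • cauchyProd (M.tenBr A (-1) 1 0 rfl) b ∘ₗ LinearMap.fst ℂ _ _)

lemma isNilpotent_formAd [IsArtinianRing A] (a : ℕ →₀ (M.ten A).V 0)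
    (b : ℕ →₀ (M.ten A).V (-1)) : IsNilpotent (formAd a b) := by
  obtain ⟨N, hN⟩ := exists_mA_pow_eq_bot A
  refine (formAd a b).isNilpotent_of_filtration
    (fun k => (Finsupp.submodule fun _ => M.tenFil A 1 k).prod
      (Finsupp.submodule fun _ => M.tenFil A 0 k)) (N := N) ?_ ?_ ?_
  · ext; simp [tenFil_zero]
  · ext ⟨u, v⟩
    simp [tenFil_eq_bot _ hN, Finsupp.mem_submodule_iff, Finsupp.ext_iff]
  · rintro k ⟨u, v⟩ ⟨hu, hv⟩
    exact ⟨cauchyProd_mem _ (tenBr_mem_tenFil rfl k) a hu,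
      add_mem (cauchyProd_mem _ (tenBr_mem_tenFil rfl k) a hv)
        (zsmul_mem (cauchyProd_mem _ (tenBr_mem_tenFil rfl k) b hu) _)⟩

lemma polyDeriv_eq_of_gauge_eq [IsArtinianRing A] (p : ℕ →₀ (M.ten A).V 1)
    (q a : ℕ →₀ (M.ten A).V 0) (b : ℕ →₀ (M.ten A).V (-1))
    (hstab : ((M.ten A).tdt).gauge (GLD.formZero a b) (GLD.formOne p q) =
      GLD.formOne p q) :
    polyDeriv a = cauchyProd (M.tenBr A 0 0 0 rfl) a q -
      polyMap (M.tenD A (-1) 0 rfl) b - cauchyProd (M.tenBr A 1 (-1) 0 rfl) p b := by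
  have hy := eq_zero_of_finsum_iterate_eq_zero (formAd a b) (isNilpotent_formAd a b) _
    (add_eq_left.mp hstab)
  have h : cauchyProd (M.tenBr A 0 0 0 rfl) a q +
      (-1 : ℤ) • cauchyProd (M.tenBr A (-1) 1 0 rfl) b p -
      (polyMap (M.tenD A (-1) 0 rfl) b + (1 : ℤ) • polyDeriv a) = 0 := by
    rw [polyMap_eq_sum]
    exact congrArg Prod.snd hy
  rw [cauchyProd_flip (M.tenBr A (-1) 1 0 rfl) (M.tenBr A 1 (-1) 0 rfl)
    (fun u v => tenBr_neg_one_one u v), neg_one_smul, one_smul] at h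
  rw [← sub_eq_zero, ← neg_eq_zero, ← h]
  abel

end Forms

section S17

variable (M : DGLA) (A : Type) [CommRing A] [Algebra ℂ A] [IsLocalRing A] [IsArtinianRing A]

/-- Let `M` be a DGLA over `ℂ` and `(A, m_A)` a local Artinian `ℂ`-algebra with residue
field `ℂ`. Let `x(t,dt)` be a Maurer-Cartan element of `M[t,dt] ⊗ m_A` and
`μ(t,dt) ∈ (M[t,dt])⁰ ⊗ m_A` with `μ(0) = 0` and `e^{μ(t,dt)} * x(t,dt) = x(t,dt)`.
Then `e^{μ(1)}` lies in the irrelevant stabilizer of `x(1)`: there exists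
`C ∈ M⁻¹ ⊗ m_A` with `μ(1) = d_M C + [x(1), C]`. -/
theorem statement17
    (hres : Function.Bijective (algebraMap ℂ (IsLocalRing.ResidueField A)))
    (x : ((M.ten A).tdt).V 1) (μ : ((M.ten A).tdt).V 0)
    (hx : ((M.ten A).tdt).MC1 x)
    (hμ0 : (M.ten A).evalT 0 0 μ = 0)
    (hstab : ((M.ten A).tdt).gauge μ x = x) :
    ∃ C : (M.ten A).V (-1),
      (M.ten A).evalT 1 0 μ =
        (M.ten A).tr (show (-1:ℤ)+1 = 0 by omega) ((M.ten A).d (-1) C) +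
          (M.ten A).tr (show (1:ℤ)+(-1) = 0 by omega)
            ((M.ten A).br 1 (-1) ((M.ten A).evalT 1 1 x) C) := by
  obtain ⟨N, hN⟩ := exists_mA_pow_eq_bot A
  have ha0 : μ.1 0 = 0 := by
    rw [← hμ0]
    exact (polyEval_zero μ.1).symm
  have hp := polyDeriv_eq_of_MC1 x.1 x.2 hx
  have ha := polyDeriv_eq_of_gauge_eq x.1 x.2 μ.1 μ.2 hstab
  rw [cauchyProd_flip (M.tenBr A 0 0 0 rfl) (-M.tenBr A 0 0 0 rfl) (fun u v => by
    rw [DGLA.tenBr_zero_zero]; rfl), cauchyProd_neg] at ha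
  obtain ⟨c, hc⟩ := exists_twisted_primitive _ _ _ (M.tenBr A 0 (-1) (-1) rfl) _ _
    DGLA.tenD_tenBr DGLA.tenBr_jacobi (M.tenFil A (-1)) (DGLA.tenFil_zero _)
    (DGLA.tenFil_eq_bot _ hN) (DGLA.tenBr_mem_tenFil rfl) x.1 x.2 μ.1 μ.2 hp ha ha0
  refine ⟨polyEvalOne c, ?_⟩
  rw [DGLA.tr_d_eq_tenD, DGLA.tr_br_eq_tenBr]
  have h := congrArg polyEvalOne hc
  rw [map_add, polyEvalOne_polyMap, polyEvalOne_cauchyProd] at h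
  have hev : ∀ {n : ℤ} (z : ((M.ten A).tdt).V n), (M.ten A).evalT 1 n z = polyEvalOne z.1 :=
    fun z => polyEval_one z.1
  rw [hev, hev]
  exact h

end S17
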